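/- In the priority evacuation model with n ≥ 1 servants, let Q, S₁, …, Sₙ be trajectories, let t ≥ 1 and y ≥ 0 satisfy 1 + (π − y)/n ≤ t ≤ 1 + (2π − y)/n, and suppose the arc measure of the set of points of the unit circle visited by the queen during [0, t] is at most y. Then for every real B, if the trajectories evacuate the queen in time B, then B ≥ t + sin((n(t − 1) + y)/2). -/

import Mathlib

open Real Set MeasureTheory
open scoped RealInnerProductSpace

noncomputable section

abbrev Plane : Type := EuclideanSpace ℝ (Fin 2)

/-- The point of the unit circle at angle `θ`. -/
def circlePt (θ : ℝ) : Plane := (WithLp.equiv 2 (Fin 2 → ℝ)).symm ![Real.cos θ, Real.sin θ]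

/-- A trajectory in the priority evacuation model: a `1`-Lipschitz function on `[0, ∞)`
starting at the origin. -/
def IsTraj (f : ℝ → Plane) : Prop :=
  LipschitzOnWith 1 f (Set.Ici 0) ∧ f 0 = 0

/-- The first-visit time of the point `p` by the queen `Q` or one of the servants `S i`. -/
def visitTime {n : ℕ} (Q : ℝ → Plane) (S : Fin n → ℝ → Plane) (p : Plane) : ℝ :=
  sInf {t : ℝ | 0 ≤ t ∧ (Q t = p ∨ ∃ i, S i t = p)}

/-- The trajectories `Q` (queen) and `S 0, …, S (n-1)` (servants) evacuate the queen in
time `B`: every point of the unit circle is visited, and the first-visit time plus the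
distance from the queen (at that moment) to the point is at most `B`. -/
def Evacuates {n : ℕ} (Q : ℝ → Plane) (S : Fin n → ℝ → Plane) (B : ℝ) : Prop :=
  ∀ p : Plane, ‖p‖ = 1 →
    (∃ t : ℝ, 0 ≤ t ∧ (Q t = p ∨ ∃ i, S i t = p)) ∧
    visitTime Q S p + ‖Q (visitTime Q S p) - p‖ ≤ B

/-- The set of angles in `[0, 2π)` whose circle point is visited by the queen at some
time in `Tset`; its Lebesgue measure is the arc measure of the queen-explored set. -/
def queenArc (Q : ℝ → Plane) (Tset : Set ℝ) : Set ℝ :=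
  {θ : ℝ | θ ∈ Set.Ico 0 (2 * π) ∧ ∃ s ∈ Tset, Q s = circlePt θ}

lemma dist_circlePt_sq (θ : ℝ) (q : Plane) :
    ‖circlePt θ - q‖ ^ 2 = (Real.cos θ - q 0) ^ 2 + (Real.sin θ - q 1) ^ 2 := by
  simp [EuclideanSpace.norm_sq_eq, Fin.sum_univ_two, circlePt]

lemma norm_circlePt (θ : ℝ) : ‖circlePt θ‖ = 1 := by
  have h := dist_circlePt_sq θ 0
  simp only [sub_zero, PiLp.zero_apply, Real.cos_sq_add_sin_sq] at h
  exact (pow_eq_one_iff_of_nonneg (norm_nonneg _) two_ne_zero).1 h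

/-- A disc of radius `ρ < 1` meets the unit circle in a set whose angles from the centre of the
disc are bounded by `arcsin ρ`. -/
lemma exists_cos_arcsin_le (q : Plane) {ρ : ℝ} (hρ : ρ < 1) :
    ∃ φ : ℝ, ∀ θ : ℝ, ‖circlePt θ - q‖ ≤ ρ → Real.cos (Real.arcsin ρ) ≤ Real.cos (θ - φ) := by
  let z : ℂ := ⟨q 0, q 1⟩
  refine ⟨z.arg, fun θ hθ => ?_⟩
  have hre : ‖z‖ * Real.cos z.arg = q 0 := Complex.norm_mul_cos_arg z
  have him : ‖z‖ * Real.sin z.arg = q 1 := Complex.norm_mul_sin_arg z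
  have hsq := dist_circlePt_sq θ q
  have hle : ‖circlePt θ - q‖ ^ 2 ≤ ρ ^ 2 := pow_le_pow_left₀ (norm_nonneg _) hθ 2
  have hρ0 : 0 ≤ ρ := (norm_nonneg _).trans hθ
  rw [hsq, ← hre, ← him] at hle
  have h1 := Real.cos_sq_add_sin_sq θ
  have h2 := Real.cos_sq_add_sin_sq z.arg
  have hkey : 1 + ‖z‖ ^ 2 - 2 * ‖z‖ * Real.cos (θ - z.arg) ≤ ρ ^ 2 := by
    rw [Real.cos_sub]
    linear_combination hle - h1 - ‖z‖ ^ 2 * h2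
  rw [Real.cos_arcsin]
  set s := √(1 - ρ ^ 2)
  have hs : s ^ 2 = 1 - ρ ^ 2 := Real.sq_sqrt (by nlinarith)
  have hs0 : 0 ≤ s := Real.sqrt_nonneg _
  by_contra! hlt
  have hz : 0 < ‖z‖ := by
    rcases (norm_nonneg z).eq_or_lt with h | h
    · rw [← h] at hkey
      nlinarith
    · exact h
  nlinarith [sq_nonneg (‖z‖ - s), mul_lt_mul_of_pos_left hlt hz]

lemma volume_cos_le_cos_sub (φ α : ℝ) (hα0 : 0 ≤ α) :
    volume {θ : ℝ | θ ∈ Ico 0 (2 * π) ∧ Real.cos α ≤ Real.cos (θ - φ)} ≤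
      ENNReal.ofReal (2 * α) := by
  let A : Set ℝ := {θ : ℝ | Real.cos α ≤ Real.cos (θ - φ)}
  have hA : MeasurableSet A := measurableSet_le measurable_const (by fun_prop)
  have hF (a : ℝ) := isAddFundamentalDomain_Ioc (T := 2 * π) Real.two_pi_pos a
  have hinv (g : AddSubgroup.zmultiples (2 * π)) :
      (fun x : ℝ => g +ᵥ x) ⁻¹' A = A := by
    obtain ⟨g, k, rfl⟩ := g
    ext x
    have : (k : ℝ) * (2 * π) + x - φ = (x - φ) + k * (2 * π) := by ring
    simp [A, AddSubgroup.vadd_def, this, Real.cos_add_int_mul_two_pi]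
  have hEq := (hF 0).measure_set_eq (hF (φ - π)) hA hinv
  have hsub : {θ : ℝ | θ ∈ Ico 0 (2 * π) ∧ Real.cos α ≤ Real.cos (θ - φ)} =
      A ∩ Ico 0 (2 * π) := by
    ext; simp [A, and_comm]
  have hIco : volume (A ∩ Ico 0 (2 * π)) = volume (A ∩ Ioc 0 (0 + 2 * π)) := by
    rw [zero_add]
    exact measure_congr ((ae_eq_refl A).inter Ico_ae_eq_Ioc)
  rw [hsub, hIco, hEq]
  have : A ∩ Ioc (φ - π) (φ - π + 2 * π) ⊆ Icc (φ - α) (φ + α) := by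
    rintro θ ⟨h, h1, h2⟩
    have habs : |θ - φ| ≤ α := by
      by_contra! hlt
      have h3 : |θ - φ| ≤ π := abs_le.2 ⟨by linarith, by linarith⟩
      have := Real.cos_lt_cos_of_nonneg_of_le_pi hα0 h3 hlt
      rw [Real.cos_abs] at this
      exact absurd h (not_le.2 this)
    have := abs_le.1 habs
    exact ⟨by linarith, by linarith⟩
  refine (measure_mono this).trans ?_
  rw [Real.volume_Icc]
  exact ENNReal.ofReal_le_ofReal (by linarith)

/-- A disc of radius `ρ < 1` covers at most arc measure `2 arcsin ρ` of the unit circle. -/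
lemma volume_circlePt_closedBall_le (q : Plane) {ρ : ℝ} (hρ0 : 0 ≤ ρ) (hρ : ρ < 1) :
    volume {θ : ℝ | θ ∈ Ico 0 (2 * π) ∧ ‖circlePt θ - q‖ ≤ ρ} ≤
      ENNReal.ofReal (2 * Real.arcsin ρ) := by
  obtain ⟨φ, hφ⟩ := exists_cos_arcsin_le q hρ
  refine (measure_mono ?_).trans
    (volume_cos_le_cos_sub φ (Real.arcsin ρ) (Real.arcsin_nonneg.2 hρ0))
  rintro θ ⟨h1, h2⟩
  exact ⟨h1, hφ θ h2⟩

lemma IsTraj.norm_sub_le {f : ℝ → Plane} (hf : IsTraj f) {s t : ℝ} (hs : 0 ≤ s) (ht : 0 ≤ t) :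
    ‖f s - f t‖ ≤ |s - t| := by
  simpa [dist_eq_norm, Real.norm_eq_abs] using hf.1.dist_le_mul s hs t ht

lemma IsTraj.one_le_of_eq {f : ℝ → Plane} (hf : IsTraj f) {s : ℝ} (hs : 0 ≤ s) {p : Plane}
    (hp : ‖p‖ = 1) (h : f s = p) : 1 ≤ s := by
  have := hf.norm_sub_le hs le_rfl
  rwa [hf.2, h, sub_zero, hp, sub_zero, abs_of_nonneg hs] at this

lemma tendsto_mul_two_arcsin (a : ℝ) :
    Filter.Tendsto (fun N : ℕ => (N + 1 : ℝ) * (2 * Real.arcsin (a / (2 * (N + 1)))))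
      Filter.atTop (nhds a) := by
  have h : HasDerivAt Real.arcsin 1 0 := by
    simpa using Real.hasDerivAt_arcsin (x := 0) (by norm_num) (by norm_num)
  have hc : Filter.Tendsto (fun N : ℕ => ‖(N + 1 : ℝ)‖) Filter.atTop Filter.atTop :=
    tendsto_norm_atTop_atTop.comp
      (Filter.tendsto_atTop_add_const_right _ 1 tendsto_natCast_atTop_atTop)
  have := (h.hasFDerivAt.lim (a / 2) hc).const_mul 2
  refine (this.congr fun N => ?_).trans (by simp [mul_div_cancel₀])
  have hN : (N + 1 : ℝ) ≠ 0 := by positivity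
  have : (N + 1 : ℝ)⁻¹ * (a / 2) = a / (2 * (N + 1)) := by field_simp
  simp only [smul_eq_mul, zero_add, Real.arcsin_zero, sub_zero, this]
  ring

/-- By time `t` a trajectory explores at most arc measure `t - 1` of the unit circle. -/
lemma IsTraj.volume_queenArc_le {f : ℝ → Plane} (hf : IsTraj f) {t : ℝ} (ht : 1 ≤ t) :
    volume (queenArc f (Icc 0 t)) ≤ ENNReal.ofReal (t - 1) := by
  have hlim := (ENNReal.continuous_ofReal.tendsto _).comp (tendsto_mul_two_arcsin (t - 1))
  have hsmall : ∀ᶠ N : ℕ in Filter.atTop, t - 1 < N :=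
    tendsto_natCast_atTop_atTop.eventually_gt_atTop _
  refine ge_of_tendsto hlim (hsmall.mono fun N hN => ?_)
  set M : ℝ := N + 1 with hM
  have hM0 : 0 < M := by positivity
  set h : ℝ := (t - 1) / M with hh
  have hh0 : 0 ≤ h := div_nonneg (by linarith) hM0.le
  have hρ : (t - 1) / (2 * M) = h / 2 := by rw [hh]; field_simp
  have hh1 : h < 1 := by rw [hh, div_lt_one hM0]; linarith
  have hMh : M * h = t - 1 := by rw [hh]; field_simp
  have hcover : queenArc f (Icc 0 t) ⊆ ⋃ k ∈ Finset.range (N + 1),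
      {θ : ℝ | θ ∈ Ico 0 (2 * π) ∧ ‖circlePt θ - f (1 + (k + 1 / 2) * h)‖ ≤ h / 2} := by
    rintro θ ⟨hθ, s, ⟨hs0, hst⟩, hs⟩
    have hs1 := hf.one_le_of_eq hs0 (norm_circlePt θ) hs
    obtain ⟨k, hk, hk1, hk2⟩ : ∃ k : ℕ, k < N + 1 ∧ 1 + k * h ≤ s ∧ s ≤ 1 + (k + 1) * h := by
      rcases hst.eq_or_lt with rfl | hlt
      · refine ⟨N, by omega, ?_, ?_⟩ <;> rw [hM] at hMh <;> nlinarith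
      · have hpos : 0 < h := div_pos (by linarith) hM0
        have hnn : 0 ≤ (s - 1) / h := div_nonneg (by linarith) hh0
        refine ⟨⌊(s - 1) / h⌋₊, ?_, ?_, ?_⟩
        · rw [Nat.floor_lt hnn, div_lt_iff₀ hpos]
          push_cast
          linarith
        · have := (le_div_iff₀ hpos).1 (Nat.floor_le hnn)
          linarith
        · have := (div_lt_iff₀ hpos).1 (Nat.lt_floor_add_one ((s - 1) / h))
          linarith
    simp only [mem_iUnion, Finset.mem_range]
    refine ⟨k, hk, hθ, ?_⟩
    rw [← hs]
    refine (hf.norm_sub_le hs0 (by positivity)).trans (abs_le.2 ⟨?_, ?_⟩) <;> nlinarith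
  calc volume (queenArc f (Icc 0 t)) ≤ _ := measure_mono hcover
    _ ≤ ∑ k ∈ Finset.range (N + 1), _ := measure_biUnion_finset_le _ _
    _ ≤ ∑ k ∈ Finset.range (N + 1), ENNReal.ofReal (2 * Real.arcsin (h / 2)) :=
        Finset.sum_le_sum fun k _ => volume_circlePt_closedBall_le _ (by linarith) (by linarith)
    _ = _ := by
        rw [Finset.sum_const, Finset.card_range, nsmul_eq_mul, Function.comp_apply, hρ,
          ENNReal.ofReal_mul hM0.le, hM, ← Nat.cast_add_one, ENNReal.ofReal_natCast]

/-- If the queen explores arc measure at most `y` by time `t` and the points unexplored by then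
have arc measure at most `z`, then `2π ≤ n (t - 1) + y + z`. -/
lemma two_pi_le_of_volume_unexplored_le {n : ℕ} {Q : ℝ → Plane} {S : Fin n → ℝ → Plane}
    (hS : ∀ i, IsTraj (S i)) {t y z : ℝ} (ht : 1 ≤ t) (hy : 0 ≤ y) (hz : 0 ≤ z)
    (harc : volume (queenArc Q (Icc 0 t)) ≤ ENNReal.ofReal y)
    (hU : volume {θ : ℝ | θ ∈ Ico 0 (2 * π) ∧ ∀ s ∈ Icc 0 t,
      ¬ (Q s = circlePt θ ∨ ∃ i, S i s = circlePt θ)} ≤ ENNReal.ofReal z) :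
    2 * π ≤ n * (t - 1) + y + z := by
  set U := {θ : ℝ | θ ∈ Ico 0 (2 * π) ∧ ∀ s ∈ Icc 0 t,
      ¬ (Q s = circlePt θ ∨ ∃ i, S i s = circlePt θ)}
  have hcover : Ico 0 (2 * π) ⊆
      (⋃ i, queenArc (S i) (Icc 0 t)) ∪ queenArc Q (Icc 0 t) ∪ U := by
    intro θ hθ
    by_cases h : ∃ s ∈ Icc 0 t, Q s = circlePt θ ∨ ∃ i, S i s = circlePt θ
    · obtain ⟨s, hs, h | ⟨i, h⟩⟩ := h
      · exact Or.inl (Or.inr ⟨hθ, s, hs, h⟩)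
      · exact Or.inl (Or.inl (mem_iUnion.2 ⟨i, hθ, s, hs, h⟩))
    · push Not at h
      exact Or.inr ⟨hθ, fun s hs => by simpa using h s hs⟩
  have hserv : volume (⋃ i, queenArc (S i) (Icc 0 t)) ≤ ENNReal.ofReal (n * (t - 1)) :=
    calc _ ≤ ∑ i, volume (queenArc (S i) (Icc 0 t)) := measure_iUnion_fintype_le _ _
      _ ≤ ∑ _i : Fin n, ENNReal.ofReal (t - 1) :=
        Finset.sum_le_sum fun i _ => (hS i).volume_queenArc_le ht
      _ = _ := by simp [ENNReal.ofReal_mul]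
  have hnt : (0 : ℝ) ≤ n * (t - 1) := mul_nonneg n.cast_nonneg (by linarith)
  have h : ENNReal.ofReal (2 * π) ≤ ENNReal.ofReal (n * (t - 1) + y + z) :=
    calc ENNReal.ofReal (2 * π) = volume (Ico 0 (2 * π)) := by rw [Real.volume_Ico, sub_zero]
      _ ≤ _ := measure_mono hcover
      _ ≤ volume (⋃ i, queenArc (S i) (Icc 0 t)) + volume (queenArc Q (Icc 0 t)) + volume U :=
        (measure_union_le _ _).trans (add_le_add_left (measure_union_le _ _) _)
      _ ≤ ENNReal.ofReal (n * (t - 1)) + ENNReal.ofReal y + ENNReal.ofReal z := by gcongr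
      _ = _ := by rw [← ENNReal.ofReal_add hnt hy, ← ENNReal.ofReal_add (by positivity) hz]
  exact (ENNReal.ofReal_le_ofReal_iff (by positivity)).1 h

lemma Evacuates.le_visitTime {n : ℕ} {Q : ℝ → Plane} {S : Fin n → ℝ → Plane} {B : ℝ}
    (hB : Evacuates Q S B) {p : Plane} (hp : ‖p‖ = 1) {t : ℝ}
    (h : ∀ s, 0 ≤ s → (Q s = p ∨ ∃ i, S i s = p) → t ≤ s) : t ≤ visitTime Q S p :=
  le_csInf (hB p hp).1 fun s hs => h s hs.1 hs.2

/-- A point unexplored at time `t` is at distance at most `B - t` from the queen at time `t`. -/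
lemma Evacuates.norm_sub_le_of_unexplored {n : ℕ} {Q : ℝ → Plane} {S : Fin n → ℝ → Plane} {B : ℝ}
    (hB : Evacuates Q S B) (hQ : IsTraj Q) {p : Plane} (hp : ‖p‖ = 1) {t : ℝ} (ht : 0 ≤ t)
    (h : ∀ s ∈ Icc 0 t, ¬ (Q s = p ∨ ∃ i, S i s = p)) : ‖p - Q t‖ ≤ B - t := by
  have hle : t ≤ visitTime Q S p := hB.le_visitTime hp fun s hs hv => by
    by_contra! hlt
    exact h s ⟨hs, hlt.le⟩ hv
  have h1 := hQ.norm_sub_le (ht.trans hle) ht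
  rw [abs_of_nonneg (by linarith)] at h1
  have h2 := norm_sub_le_norm_sub_add_norm_sub p (Q (visitTime Q S p)) (Q t)
  have h3 := (hB p hp).2
  rw [norm_sub_rev] at h3
  linarith

/-- If the arc measure that can be explored by time `t` is at most `2π`, then the evacuation time
is at least `t`. -/
lemma Evacuates.le_of_exploration_le {n : ℕ} (hn : 1 ≤ n) {Q : ℝ → Plane}
    {S : Fin n → ℝ → Plane} {B : ℝ}
    (hB : Evacuates Q S B) (hQ : IsTraj Q) (hS : ∀ i, IsTraj (S i)) {t y : ℝ} (hy : 0 ≤ y)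
    (hhi : n * (t - 1) + y ≤ 2 * π)
    (harc : volume (queenArc Q (Icc 0 t)) ≤ ENNReal.ofReal y) : t ≤ B := by
  by_contra! hlt
  have hvB (p : Plane) (hp : ‖p‖ = 1) : visitTime Q S p ≤ B := by
    linarith [(hB p hp).2, norm_nonneg (Q (visitTime Q S p) - p)]
  have hB1 : 1 ≤ B := by
    refine le_trans (hB.le_visitTime (norm_circlePt 0) fun s hs hv => ?_)
      (hvB _ (norm_circlePt 0))
    rcases hv with h | ⟨i, h⟩
    · exact hQ.one_le_of_eq hs (norm_circlePt 0) h
    · exact (hS i).one_le_of_eq hs (norm_circlePt 0) h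
  obtain ⟨u, hBu, hut⟩ := exists_between hlt
  have hmono : queenArc Q (Icc 0 u) ⊆ queenArc Q (Icc 0 t) :=
    fun θ ⟨hθ, s, hs, h⟩ => ⟨hθ, s, ⟨hs.1, hs.2.trans hut.le⟩, h⟩
  have hempty : {θ : ℝ | θ ∈ Ico 0 (2 * π) ∧ ∀ s ∈ Icc 0 u,
      ¬ (Q s = circlePt θ ∨ ∃ i, S i s = circlePt θ)} = ∅ := by
    refine eq_empty_of_forall_notMem fun θ ⟨_, h⟩ => ?_
    have := hB.norm_sub_le_of_unexplored hQ (norm_circlePt θ) (by linarith) h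
    linarith [norm_nonneg (circlePt θ - Q u)]
  have h := two_pi_le_of_volume_unexplored_le hS (by linarith) hy le_rfl
    ((measure_mono hmono).trans harc) (by rw [hempty]; simp)
  have hn' : (0 : ℝ) < n := by exact_mod_cast hn
  nlinarith

/-- if by time `t` the queen has explored arc measure at most `y`, with
`1 + (π - y)/n ≤ t ≤ 1 + (2π - y)/n`, then the evacuation time is at least
`t + sin ((n (t - 1) + y)/2)`. -/
theorem lower_bound_from_queen_exploration
    (n : ℕ) (hn : 1 ≤ n) (Q : ℝ → Plane) (S : Fin n → ℝ → Plane)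
    (hQ : IsTraj Q) (hS : ∀ i, IsTraj (S i))
    (t y : ℝ) (ht1 : 1 ≤ t) (hy : 0 ≤ y)
    (hlo : 1 + (π - y) / n ≤ t) (hhi : t ≤ 1 + (2 * π - y) / n)
    (harc : volume (queenArc Q (Set.Icc 0 t)) ≤ ENNReal.ofReal y)
    (B : ℝ) (hB : Evacuates Q S B) :
    t + Real.sin ((n * (t - 1) + y) / 2) ≤ B := by
  have hn' : (0 : ℝ) < n := by exact_mod_cast hn
  have hx1 : π ≤ n * (t - 1) + y := by
    have := (div_le_iff₀' hn').1 (show (π - y) / n ≤ t - 1 by linarith)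
    linarith
  have hx2 : n * (t - 1) + y ≤ 2 * π := by
    have := (le_div_iff₀' hn').1 (show t - 1 ≤ (2 * π - y) / n by linarith)
    linarith
  have htB : t ≤ B := hB.le_of_exploration_le hn hQ hS hy hx2 harc
  by_contra! hlt
  have hρ : B - t < 1 := by linarith [Real.sin_le_one ((n * (t - 1) + y) / 2)]
  have hU : volume {θ : ℝ | θ ∈ Ico 0 (2 * π) ∧ ∀ s ∈ Icc 0 t,
      ¬ (Q s = circlePt θ ∨ ∃ i, S i s = circlePt θ)} ≤
      ENNReal.ofReal (2 * Real.arcsin (B - t)) := by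
    refine (measure_mono ?_).trans
      (volume_circlePt_closedBall_le (Q t) (sub_nonneg.2 htB) hρ)
    rintro θ ⟨hθ, h⟩
    exact ⟨hθ, hB.norm_sub_le_of_unexplored hQ (norm_circlePt θ) (by linarith) h⟩
  have h2π := two_pi_le_of_volume_unexplored_le hS ht1 hy
    (mul_nonneg zero_le_two (Real.arcsin_nonneg.2 (sub_nonneg.2 htB))) harc hU
  have hle : Real.sin (π - (n * (t - 1) + y) / 2) ≤ B - t :=
    (Real.le_arcsin_iff_sin_le ⟨by linarith, by linarith⟩ ⟨by linarith, hρ.le⟩).1 (by linarith)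
  rw [Real.sin_pi_sub] at hle
  linarith
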